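/- arXiv:math-ph/0508042 — 3 statements merged into one kernel-verified Lean document; each statement's English description precedes it below -/
import Mathlib

section
/- Let n ≥ 1 and m > 0. If u : ℝⁿ × ℝ → ℂ is a C² function satisfying ∂²_t u(x,t) = Δ_x u(x,t) − m² u(x,t) for all (x,t) ∈ ℝⁿ × ℝ, and u(x,0) = 0 and ∂_t u(x,0) = 0 for all x ∈ ℝⁿ, then u(x,t) = 0 for all (x,t) ∈ ℝⁿ × ℝ. -/
open Set Filter Topology MeasureTheory

/-- Differentiation under the integral sign for a `C¹` integrand whose support in the space
variable stays, for times after `a`, in a fixed compact set. -/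
theorem hasDerivAt_integral_of_contDiff_of_isCompact {n : ℕ}
    {H : EuclideanSpace ℝ (Fin n) × ℝ → ℝ} (hH : ContDiff ℝ 1 H)
    {K : Set (EuclideanSpace ℝ (Fin n))} (hK : IsCompact K) {a : ℝ}
    (h0 : ∀ x ∉ K, ∀ t, a < t → H (x, t) = 0) {t : ℝ} (ht : a < t) :
    HasDerivAt (fun s => ∫ x, H (x, s)) (∫ x, fderiv ℝ H (x, t) (0, 1)) t := by
  have hcont : Continuous fun p => fderiv ℝ H p (0, 1) :=
    (hH.continuous_fderiv one_ne_zero).clm_apply continuous_const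
  have hderiv : ∀ x s, HasDerivAt (fun r => H (x, r)) (fderiv ℝ H (x, s) (0, 1)) s := fun x s =>
    ((hH.differentiable one_ne_zero) (x, s)).hasFDerivAt.comp_hasDerivAt s
      ((hasDerivAt_const s x).prodMk (hasDerivAt_id s))
  obtain ⟨δ, hδ, hδa⟩ : ∃ δ > 0, a < t - δ := ⟨(t - a) / 2, by linarith, by linarith⟩
  obtain ⟨C, hC⟩ := (hK.prod (isCompact_Icc (a := t - δ) (b := t + δ))).exists_bound_of_continuousOn
    hcont.continuousOn
  refine (hasDerivAt_integral_of_dominated_loc_of_deriv_le (F := fun s x => H (x, s))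
    (F' := fun s x => fderiv ℝ H (x, s) (0, 1)) (s := Icc (t - δ) (t + δ))
    (bound := K.indicator fun _ => C) (Icc_mem_nhds (by linarith) (by linarith)) ?_ ?_ ?_ ?_ ?_
    ?_).2
  · exact Eventually.of_forall fun s =>
      (hH.continuous.comp (by fun_prop : Continuous fun x => (x, s))).aestronglyMeasurable
  · exact Continuous.integrable_of_hasCompactSupport
      (hH.continuous.comp (by fun_prop : Continuous fun x => (x, t)))
      (HasCompactSupport.intro hK fun x hx => h0 x hx t ht)
  · exact (hcont.comp (by fun_prop : Continuous fun x => (x, t))).aestronglyMeasurable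
  · refine Eventually.of_forall fun x s hs => ?_
    by_cases hx : x ∈ K
    · simpa [hx] using hC (x, s) ⟨hx, hs⟩
    · have : HasDerivAt (fun r => H (x, r)) 0 s :=
        (hasDerivAt_const s (0 : ℝ)).congr_of_eventuallyEq
          ((eventually_gt_nhds (hδa.trans_le hs.1)).mono fun r hr => h0 x hx r hr)
      simp [hx, (hderiv x s).unique this]
  · exact (integrable_indicator_iff hK.measurableSet).2
      (integrableOn_const hK.measure_lt_top.ne)
  · exact Eventually.of_forall fun x s _ => hderiv x s

/-- The integral of a directional derivative of a compactly supported `C¹` function vanishes. -/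
theorem integral_fderiv_apply_eq_zero {n : ℕ} {f : EuclideanSpace ℝ (Fin n) → ℝ}
    (hf : ContDiff ℝ 1 f) (hc : HasCompactSupport f) (v : EuclideanSpace ℝ (Fin n)) :
    ∫ x, fderiv ℝ f x v = 0 := by
  have hint : Integrable fun x => fderiv ℝ f x v :=
    ((hf.continuous_fderiv one_ne_zero).clm_apply continuous_const).integrable_of_hasCompactSupport
      (hc.fderiv_apply (𝕜 := ℝ) v)
  have := integral_mul_fderiv_eq_neg_fderiv_mul_of_integrable (μ := volume)
    (f := fun _ : EuclideanSpace ℝ (Fin n) => (1 : ℝ)) (g := f) (v := v) (by simp)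
    (by simpa using hint)
    (by simpa using hf.continuous.integrable_of_hasCompactSupport hc)
    (fun _ _ => differentiableAt_const _) (fun x _ => (hf.differentiable one_ne_zero) x)
  simpa using this

/-- A nonnegative density `e` satisfying a conservation law `∂ₜ e = div j` whose flux obeys
`|j| ≤ e` propagates with speed at most one: if `e` vanishes initially, it vanishes later. -/
theorem eq_zero_of_conservation_law {n : ℕ}
    {e : EuclideanSpace ℝ (Fin n) × ℝ → ℝ} {j : Fin n → EuclideanSpace ℝ (Fin n) × ℝ → ℝ}
    (he : ContDiff ℝ 1 e) (hj : ∀ i, ContDiff ℝ 1 (j i))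
    (hcons : ∀ p, fderiv ℝ e p (0, 1) =
      ∑ i, fderiv ℝ (j i) p (EuclideanSpace.single i 1, 0))
    (hnonneg : ∀ p, 0 ≤ e p) (hflux : ∀ p, ∑ i, j i p ^ 2 ≤ e p ^ 2)
    (hzero : ∀ x, e (x, 0) = 0) (x₀ : EuclideanSpace ℝ (Fin n)) {T : ℝ} (hT : 0 ≤ T) :
    e (x₀, T) = 0 := by
  obtain ⟨R, hR⟩ : ∃ R, R = T + 1 := ⟨_, rfl⟩
  have hRpos : 0 < R := by linarith
  obtain ⟨ε, hε⟩ : ∃ ε, ε = 1 / (4 * R) := ⟨_, rfl⟩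
  have hεpos : 0 < ε := by rw [hε]; positivity
  have hεR : 4 * ε * R = 1 := by rw [hε]; field_simp
  -- The cutoff is supported in a paraboloid on which `‖∇ₓ g‖ ≤ 1` for nonnegative times.
  let g : EuclideanSpace ℝ (Fin n) × ℝ → ℝ := fun p => R - p.2 - ε * ‖p.1 - x₀‖ ^ 2
  let χ : EuclideanSpace ℝ (Fin n) × ℝ → ℝ := fun p => expNegInvGlue (g p)
  have hφ : ContDiff ℝ 1 expNegInvGlue := expNegInvGlue.contDiff (n := 1)
  have hg : ContDiff ℝ 1 g := by
    have : ContDiff ℝ 1 fun p : EuclideanSpace ℝ (Fin n) × ℝ => ‖p.1 - x₀‖ ^ 2 :=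
      (contDiff_fst.sub contDiff_const).norm_sq ℝ
    fun_prop
  have hχ : ContDiff ℝ 1 χ := hφ.comp hg
  have hgd : ∀ p v, fderiv ℝ g p v = -v.2 - ε * (2 * inner ℝ (p.1 - x₀) v.1) := by
    intro p v
    have h1 : HasFDerivAt (fun p : EuclideanSpace ℝ (Fin n) × ℝ => p.1 - x₀)
        (ContinuousLinearMap.fst ℝ _ _) p := hasFDerivAt_fst.sub_const x₀
    have h2 := ((hasFDerivAt_snd (𝕜 := ℝ) (p := p)).const_sub R).sub (h1.norm_sq.const_mul ε)
    have h3 : HasFDerivAt g _ p := h2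
    rw [h3.fderiv]
    simp [inner_sub_left]
  have hχd : ∀ p v, fderiv ℝ χ p v = deriv expNegInvGlue (g p) * fderiv ℝ g p v := by
    intro p v
    have h := ((hφ.differentiable one_ne_zero) (g p)).hasDerivAt.comp_hasFDerivAt p
      ((hg.differentiable one_ne_zero) p).hasFDerivAt
    have h3 : HasFDerivAt χ _ p := h
    rw [h3.fderiv]
    simp
  have hmul : ∀ f : EuclideanSpace ℝ (Fin n) × ℝ → ℝ, ContDiff ℝ 1 f → ∀ p v,
      fderiv ℝ (fun q => χ q * f q) p v = χ p * fderiv ℝ f p v + fderiv ℝ χ p v * f p := by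
    intro f hf p v
    rw [fderiv_fun_mul ((hχ.differentiable one_ne_zero) p) ((hf.differentiable one_ne_zero) p)]
    simp [mul_comm]
  let K := Metric.closedBall x₀ (√((R + 1) / ε))
  have hK : IsCompact K := isCompact_closedBall _ _
  have hχK : ∀ x ∉ K, ∀ t, -1 < t → χ (x, t) = 0 := by
    intro x hx t ht
    apply expNegInvGlue.zero_of_nonpos
    have h1 : √((R + 1) / ε) < ‖x - x₀‖ := by
      simpa [K, dist_eq_norm] using hx
    have h2 : (R + 1) / ε < ‖x - x₀‖ ^ 2 := (Real.sqrt_lt' ((Real.sqrt_nonneg _).trans_lt h1)).1 h1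
    rw [div_lt_iff₀ hεpos] at h2
    simp only [g]
    linarith
  have hsupp : ∀ (f : EuclideanSpace ℝ (Fin n) × ℝ → ℝ) (t : ℝ), -1 < t →
      HasCompactSupport fun x => χ (x, t) * f (x, t) := fun f t ht =>
    HasCompactSupport.intro hK fun x hx => by simp [hχK x hx t ht]
  have hslice : ∀ t : ℝ, ContDiff ℝ 1 fun x : EuclideanSpace ℝ (Fin n) => (x, t) := fun t => by
    fun_prop
  have hsliced : ∀ (f : EuclideanSpace ℝ (Fin n) × ℝ → ℝ), ContDiff ℝ 1 f → ∀ t x v,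
      fderiv ℝ (fun y => f (y, t)) x v = fderiv ℝ f (x, t) (v, 0) := by
    intro f hf t x v
    have h := ((hf.differentiable one_ne_zero) (x, t)).hasFDerivAt.comp x
      (hasFDerivAt_prodMk_left (𝕜 := ℝ) x t)
    have h3 : HasFDerivAt (fun y => f (y, t)) _ x := h
    rw [h3.fderiv]
    simp
  have hI : ∀ t, -1 < t → HasDerivAt (fun s => ∫ x, χ (x, s) * e (x, s))
      (∫ x, fderiv ℝ (fun q => χ q * e q) (x, t) (0, 1)) t := fun t ht =>
    hasDerivAt_integral_of_contDiff_of_isCompact (hχ.mul he) hK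
      (fun x hx s hs => by simp [hχK x hx s hs]) ht
  have hdiv : ∀ t, -1 < t → ∀ i,
      ∫ x, fderiv ℝ (fun q => χ q * j i q) (x, t) (EuclideanSpace.single i 1, 0) = 0 := by
    intro t ht i
    exact (integral_congr_ae (Eventually.of_forall fun x =>
      (hsliced _ (hχ.mul (hj i)) t x _).symm)).trans
        (integral_fderiv_apply_eq_zero ((hχ.mul (hj i)).comp (hslice t)) (hsupp (j i) t ht) _)
  have hle : ∀ t, 0 ≤ t → ∫ x, fderiv ℝ (fun q => χ q * e q) (x, t) (0, 1) ≤ 0 := by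
    intro t ht
    have hint : ∀ i, Integrable fun x =>
        fderiv ℝ (fun q => χ q * j i q) (x, t) (EuclideanSpace.single i 1, 0) := by
      intro i
      have hs := (hsupp (j i) t (by linarith)).fderiv_apply (𝕜 := ℝ) (EuclideanSpace.single i 1)
      have hc := (((hχ.mul (hj i)).comp (hslice t)).continuous_fderiv one_ne_zero).clm_apply
        (continuous_const (y := EuclideanSpace.single i (1 : ℝ)))
      exact (hc.integrable_of_hasCompactSupport hs).congr (Eventually.of_forall fun x =>
        hsliced _ (hχ.mul (hj i)) t x _)
    calc ∫ x, fderiv ℝ (fun q => χ q * e q) (x, t) (0, 1)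
        ≤ ∫ x, ∑ i, fderiv ℝ (fun q => χ q * j i q) (x, t) (EuclideanSpace.single i 1, 0) := by
          by_cases hA : Integrable fun x => fderiv ℝ (fun q => χ q * e q) (x, t) (0, 1)
          · refine integral_mono hA (integrable_finsetSum _ fun i _ => hint i) fun x => ?_
            simp only [hmul e he, hmul _ (hj _), hχd, hgd, hcons, Finset.sum_add_distrib,
              Finset.mul_sum]
            gcongr
            simp only [inner_zero_right, EuclideanSpace.inner_single_right]
            rcases le_or_gt (g (x, t)) 0 with hgn | hgp
            · have hmin : deriv expNegInvGlue (g (x, t)) = 0 := by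
                refine IsLocalMin.deriv_eq_zero (Eventually.of_forall fun s => ?_)
                rw [expNegInvGlue.zero_of_nonpos hgn]
                exact expNegInvGlue.nonneg s
              simp [hmin]
            · have hcs := Finset.sum_mul_sq_le_sq_mul_sq Finset.univ
                (fun i => (x - x₀) i) (fun i => j i (x, t))
              rw [← EuclideanSpace.real_norm_sq_eq] at hcs
              have hball : ε * ‖x - x₀‖ ^ 2 ≤ R := by
                simp only [g] at hgp
                linarith
              have hsq : (2 * ε * ∑ i, (x - x₀) i * j i (x, t)) ^ 2 ≤ e (x, t) ^ 2 :=
                calc (2 * ε * ∑ i, (x - x₀) i * j i (x, t)) ^ 2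
                    = 4 * ε ^ 2 * (∑ i, (x - x₀) i * j i (x, t)) ^ 2 := by ring
                  _ ≤ 4 * ε ^ 2 * (‖x - x₀‖ ^ 2 * e (x, t) ^ 2) := by
                    gcongr
                    exact hcs.trans (by gcongr; exact hflux _)
                  _ = 4 * ε * (ε * ‖x - x₀‖ ^ 2) * e (x, t) ^ 2 := by ring
                  _ ≤ 4 * ε * R * e (x, t) ^ 2 := by gcongr
                  _ = e (x, t) ^ 2 := by rw [hεR, one_mul]
              have hmain := mul_le_mul_of_nonneg_left (abs_le_of_sq_le_sq' hsq (hnonneg _)).2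
                (expNegInvGlue.monotone.deriv_nonneg (x := g (x, t)))
              rw [Finset.mul_sum, Finset.mul_sum] at hmain
              rw [← neg_le_neg_iff, ← Finset.sum_neg_distrib]
              convert hmain using 1
              · exact Finset.sum_congr rfl fun i _ => by simp; ring
              · ring
          · rw [integral_undef hA, integral_finsetSum _ fun i _ => hint i]
            simp [hdiv t (by linarith)]
      _ = 0 := by
          rw [integral_finsetSum _ fun i _ => hint i]
          exact Finset.sum_eq_zero fun i _ => hdiv t (by linarith) i
  have hanti : AntitoneOn (fun s => ∫ x, χ (x, s) * e (x, s)) (Icc 0 T) := by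
    refine antitoneOn_of_deriv_nonpos (convex_Icc 0 T)
      (fun t ht => (hI t (by linarith [ht.1])).continuousAt.continuousWithinAt)
      (fun t ht => ?_) fun t ht => ?_
    · rw [interior_Icc] at ht
      exact (hI t (by linarith [ht.1])).differentiableAt.differentiableWithinAt
    · rw [interior_Icc] at ht
      rw [(hI t (by linarith [ht.1])).deriv]
      exact hle t ht.1.le
  have hIT : ∫ x, χ (x, T) * e (x, T) ≤ 0 := by
    simpa [hzero] using hanti (left_mem_Icc.2 hT) (right_mem_Icc.2 hT) hT
  by_contra hne
  refine hIT.not_gt (Continuous.integral_pos_of_hasCompactSupport_nonneg_nonzero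
    (x := x₀) ((hχ.mul he).comp (hslice T)).continuous (hsupp e T (by linarith))
    (fun x => mul_nonneg (expNegInvGlue.nonneg _) (hnonneg _)) ?_)
  refine mul_ne_zero (expNegInvGlue.pos_of_pos ?_).ne' hne
  simp [g, hR]

/-- Forward-in-time uniqueness for the Klein–Gordon equation with vanishing initial data. -/
theorem kleinGordon_eq_zero_of_nonneg {n : ℕ} {m : ℝ} (hm : 0 < m)
    {u : EuclideanSpace ℝ (Fin n) × ℝ → ℂ} (hu : ContDiff ℝ 2 u)
    (hKG : ∀ (x : EuclideanSpace ℝ (Fin n)) (t : ℝ),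
      deriv (fun s => deriv (fun r => u (x, r)) s) t =
        (∑ i : Fin n,
          fderiv ℝ (fun y => fderiv ℝ (fun z => u (z, t)) y (EuclideanSpace.single i 1)) x
            (EuclideanSpace.single i 1))
        - (m : ℂ) ^ 2 * u (x, t))
    (hu0 : ∀ x : EuclideanSpace ℝ (Fin n), u (x, 0) = 0)
    (hv0 : ∀ x : EuclideanSpace ℝ (Fin n), deriv (fun s => u (x, s)) 0 = 0)
    (x : EuclideanSpace ℝ (Fin n)) {t : ℝ} (ht : 0 ≤ t) : u (x, t) = 0 := by
  let a : EuclideanSpace ℝ (Fin n) × ℝ → ℂ := fun p => fderiv ℝ u p (0, 1)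
  let b : Fin n → EuclideanSpace ℝ (Fin n) × ℝ → ℂ :=
    fun i p => fderiv ℝ u p (EuclideanSpace.single i 1, 0)
  have hDu : ContDiff ℝ 1 (fderiv ℝ u) := hu.fderiv_right (by norm_num)
  have ha : ContDiff ℝ 1 a := hDu.clm_apply contDiff_const
  have hb : ∀ i, ContDiff ℝ 1 (b i) := fun i => hDu.clm_apply contDiff_const
  have hu1 : ContDiff ℝ 1 u := hu.of_le (by norm_num)
  have htime : ∀ f : EuclideanSpace ℝ (Fin n) × ℝ → ℂ, ContDiff ℝ 1 f → ∀ y s,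
      deriv (fun r => f (y, r)) s = fderiv ℝ f (y, s) (0, 1) := fun f hf y s =>
    (((hf.differentiable one_ne_zero) (y, s)).hasFDerivAt.comp_hasDerivAt s
      ((hasDerivAt_const s y).prodMk (hasDerivAt_id s))).deriv
  have hspace : ∀ f : EuclideanSpace ℝ (Fin n) × ℝ → ℂ, ContDiff ℝ 1 f → ∀ y s v,
      fderiv ℝ (fun z => f (z, s)) y v = fderiv ℝ f (y, s) (v, 0) := by
    intro f hf y s v
    have h : HasFDerivAt (fun z => f (z, s)) _ y :=
      ((hf.differentiable one_ne_zero) (y, s)).hasFDerivAt.comp y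
        (hasFDerivAt_prodMk_left (𝕜 := ℝ) y s)
    rw [h.fderiv]
    simp
  have hcomm : ∀ i p, fderiv ℝ (b i) p (0, 1) = fderiv ℝ a p (EuclideanSpace.single i 1, 0) := by
    intro i p
    have hd := (hDu.differentiable one_ne_zero) p
    have hsymm := (hu.contDiffAt (x := p)).isSymmSndFDerivAt (by simp)
    simp only [a, b]
    rw [fderiv_clm_apply hd (differentiableAt_const _),
      fderiv_clm_apply hd (differentiableAt_const _)]
    simpa using hsymm (0, 1) (EuclideanSpace.single i 1, 0)
  have hwave : ∀ p, fderiv ℝ a p (0, 1) =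
      (∑ i, fderiv ℝ (b i) p (EuclideanSpace.single i 1, 0)) - m ^ 2 • u p := by
    rintro ⟨y, s⟩
    have h := hKG y s
    simp only [htime u hu1, hspace u hu1] at h
    rw [htime a ha] at h
    rw [h, Complex.real_smul]
    push_cast
    congr 1
    exact Finset.sum_congr rfl fun i _ => hspace (b i) (hb i) y s _
  let e : EuclideanSpace ℝ (Fin n) × ℝ → ℝ :=
    fun p => ‖a p‖ ^ 2 + ∑ i, ‖b i p‖ ^ 2 + m ^ 2 * ‖u p‖ ^ 2
  let j : Fin n → EuclideanSpace ℝ (Fin n) × ℝ → ℝ := fun i p => 2 * inner ℝ (a p) (b i p)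
  have he : ContDiff ℝ 1 e :=
    ((ha.norm_sq ℝ).add (ContDiff.sum fun i _ => (hb i).norm_sq ℝ)).add
      (contDiff_const.mul (hu1.norm_sq ℝ))
  have hj : ∀ i, ContDiff ℝ 1 (j i) := fun i => contDiff_const.mul (ha.inner ℝ (hb i))
  have hcons : ∀ p, fderiv ℝ e p (0, 1) =
      ∑ i, fderiv ℝ (j i) p (EuclideanSpace.single i 1, 0) := by
    intro p
    have had := (ha.differentiable one_ne_zero p)
    have hbd := fun i => (hb i).differentiable one_ne_zero p
    have hed : HasFDerivAt e _ p :=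
      (had.hasFDerivAt.norm_sq.add
        (HasFDerivAt.fun_sum fun i (_ : i ∈ Finset.univ) => (hbd i).hasFDerivAt.norm_sq)).add
        ((hu1.differentiable one_ne_zero p).hasFDerivAt.norm_sq.const_mul (m ^ 2))
    have hjd : ∀ i v, fderiv ℝ (j i) p v =
        2 * (inner ℝ (a p) (fderiv ℝ (b i) p v) + inner ℝ (fderiv ℝ a p v) (b i p)) := by
      intro i v
      rw [← fderiv_inner_apply ℝ had (hbd i)]
      simp only [j]
      rw [fderiv_const_mul (had.inner ℝ (hbd i))]
      simp
    have hau : fderiv ℝ u p (0, 1) = a p := rfl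
    have hinner : inner ℝ (a p) (fderiv ℝ a p (0, 1)) =
        (∑ i, inner ℝ (a p) (fderiv ℝ (b i) p (EuclideanSpace.single i 1, 0))) -
          m ^ 2 * inner ℝ (u p) (a p) := by
      rw [hwave, inner_sub_right, inner_sum, real_inner_smul_right, real_inner_comm]
    simp only [hed.fderiv, hjd, ← hcomm]
    simp [-Complex.inner, hau, hinner, mul_sub, Finset.sum_add_distrib, mul_add, Finset.mul_sum,
      real_inner_comm (b _ p) (fderiv ℝ (b _) p _)]
    ring
  have hflux : ∀ p, ∑ i, j i p ^ 2 ≤ e p ^ 2 := by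
    intro p
    have hB : 0 ≤ ∑ i, ‖b i p‖ ^ 2 := by positivity
    calc ∑ i, j i p ^ 2 ≤ ∑ i, 4 * ‖a p‖ ^ 2 * ‖b i p‖ ^ 2 := by
          refine Finset.sum_le_sum fun i _ => ?_
          have := sq_le_sq.2 ((abs_real_inner_le_norm (a p) (b i p)).trans (le_abs_self _))
          simp only [j]
          nlinarith
      _ = 4 * ‖a p‖ ^ 2 * ∑ i, ‖b i p‖ ^ 2 := by rw [Finset.mul_sum]
      _ ≤ (‖a p‖ ^ 2 + ∑ i, ‖b i p‖ ^ 2) ^ 2 := by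
          nlinarith [sq_nonneg (‖a p‖ ^ 2 - ∑ i, ‖b i p‖ ^ 2)]
      _ ≤ e p ^ 2 := by
          have : 0 ≤ m ^ 2 * ‖u p‖ ^ 2 := by positivity
          simp only [e]
          exact pow_le_pow_left₀ (by positivity) (by linarith) 2
  have hzero : ∀ y, e (y, 0) = 0 := by
    intro y
    have ha0 : a (y, 0) = 0 := by simpa only [htime u hu1] using hv0 y
    have hb0 : ∀ i, b i (y, 0) = 0 := fun i => by
      simp only [b, ← hspace u hu1, hu0]
      simp
    simp [e, ha0, hb0, hu0]
  have h := eq_zero_of_conservation_law he hj hcons (fun p => by positivity) hflux hzero x ht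
  have hB : 0 ≤ ∑ i, ‖b i (x, t)‖ ^ 2 := by positivity
  have hmu : m ^ 2 * ‖u (x, t)‖ ^ 2 = 0 := by
    simp only [e] at h
    have : 0 ≤ m ^ 2 * ‖u (x, t)‖ ^ 2 := by positivity
    nlinarith [sq_nonneg ‖a (x, t)‖]
  simpa [hm.ne'] using hmu

/-- Uniqueness for the Cauchy problem for the Klein–Gordon equation with constant
coefficients: a `C²` solution of `∂²_t u = Δ_x u − m² u` with vanishing initial data
`u(·,0) = 0`, `∂_t u(·,0) = 0` vanishes identically. -/
theorem kleinGordon_cauchy_uniqueness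
    (n : ℕ) (hn : 1 ≤ n) (m : ℝ) (hm : 0 < m)
    (u : EuclideanSpace ℝ (Fin n) × ℝ → ℂ)
    (hu : ContDiff ℝ 2 u)
    (hKG : ∀ (x : EuclideanSpace ℝ (Fin n)) (t : ℝ),
      deriv (fun s => deriv (fun r => u (x, r)) s) t =
        (∑ i : Fin n,
          fderiv ℝ (fun y => fderiv ℝ (fun z => u (z, t)) y (EuclideanSpace.single i 1)) x
            (EuclideanSpace.single i 1))
        - (m : ℂ) ^ 2 * u (x, t))
    (hu0 : ∀ x : EuclideanSpace ℝ (Fin n), u (x, 0) = 0)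
    (hv0 : ∀ x : EuclideanSpace ℝ (Fin n), deriv (fun s => u (x, s)) 0 = 0) :
    ∀ (x : EuclideanSpace ℝ (Fin n)) (t : ℝ), u (x, t) = 0 := by
  intro x t
  rcases le_total 0 t with ht | ht
  · exact kleinGordon_eq_zero_of_nonneg hm hu hKG hu0 hv0 x ht
  · have h := kleinGordon_eq_zero_of_nonneg (u := fun p => u (p.1, -p.2)) hm
      (hu.comp (contDiff_fst.prodMk contDiff_snd.neg)) ?_ (by simpa using hu0) ?_ x
      (neg_nonneg.2 ht)
    · simpa using h
    · intro y s
      have hd : ∀ r, deriv (fun q => u (y, -q)) r = -deriv (fun q => u (y, q)) (-r) :=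
        fun r => deriv_comp_neg (fun q => u (y, q)) r
      simp only [hd, deriv.fun_neg]
      rw [deriv_comp_neg (fun r => deriv (fun q => u (y, q)) r) s, neg_neg]
      exact hKG y (-s)
    · intro y
      simpa [hv0] using deriv_comp_neg (fun q => u (y, q)) 0
end

section
/- Let n ≥ 1 be an integer and let φ : [0, ∞) → [0, ∞) be a nonincreasing function. Then ∫₀^∞ r^{2n−1} φ(r) dr ≤ n · ( ∫₀^∞ r^{n−1} φ(r)^{1/2} dr )². -/
open MeasureTheory

/-- For `c ≥ 0`, `rⁿ c = n ∫₀^r s^{n−1} c ds` as an identity of extended nonnegative reals. -/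
lemma ofReal_pow_mul_eq_lintegral {n : ℕ} (hn : 1 ≤ n) {r c : ℝ} (hr : 0 ≤ r) (hc : 0 ≤ c) :
    ENNReal.ofReal (r ^ n * c) =
      n * ∫⁻ s in Set.Ioc (0 : ℝ) r, ENNReal.ofReal (s ^ (n - 1) * c) := by
  have hint : IntegrableOn (fun s : ℝ => s ^ (n - 1) * c) (Set.Ioc 0 r) :=
    (by fun_prop : Continuous fun s : ℝ => s ^ (n - 1) * c).integrableOn_Ioc
  have hpos : 0 ≤ᵐ[volume.restrict (Set.Ioc 0 r)] fun s : ℝ => s ^ (n - 1) * c :=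
    (ae_restrict_iff' measurableSet_Ioc).2 <| .of_forall fun s hs =>
      mul_nonneg (pow_nonneg hs.1.le _) hc
  rw [← ofReal_integral_eq_lintegral_ofReal hint hpos, ← intervalIntegral.integral_of_le hr,
    intervalIntegral.integral_mul_const, integral_pow, ← ENNReal.ofReal_natCast,
    ← ENNReal.ofReal_mul n.cast_nonneg]
  obtain ⟨m, rfl⟩ := Nat.exists_eq_add_of_le' hn
  congr 1
  have : (m : ℝ) + 1 ≠ 0 := by positivity
  simp
  field_simp

/-- For a nonnegative nonincreasing `ψ`, the quantity `rⁿ ψ(r)` is controlled by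
`n ∫₀^∞ s^{n−1} ψ(s) ds`. -/
lemma ofReal_pow_mul_le_lintegral_of_antitoneOn {n : ℕ} (hn : 1 ≤ n) {ψ : ℝ → ℝ}
    (hnonneg : ∀ r, 0 ≤ r → 0 ≤ ψ r) (hmono : AntitoneOn ψ (Set.Ici 0)) {r : ℝ} (hr : 0 ≤ r) :
    ENNReal.ofReal (r ^ n * ψ r) ≤
      n * ∫⁻ s in Set.Ioi (0 : ℝ), ENNReal.ofReal (s ^ (n - 1) * ψ s) := by
  rw [ofReal_pow_mul_eq_lintegral hn hr (hnonneg r hr)]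
  refine mul_le_mul_right ?_ _
  calc ∫⁻ s in Set.Ioc (0 : ℝ) r, ENNReal.ofReal (s ^ (n - 1) * ψ r)
      ≤ ∫⁻ s in Set.Ioc (0 : ℝ) r, ENNReal.ofReal (s ^ (n - 1) * ψ s) :=
        setLIntegral_mono' measurableSet_Ioc fun s hs => ENNReal.ofReal_le_ofReal <|
          mul_le_mul_of_nonneg_left (hmono hs.1.le hr hs.2) (pow_nonneg hs.1.le _)
    _ ≤ ∫⁻ s in Set.Ioi (0 : ℝ), ENNReal.ofReal (s ^ (n - 1) * ψ s) :=
        lintegral_mono_set Set.Ioc_subset_Ioi_self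

/-- For a nonincreasing nonnegative function `φ` on `[0,∞)`,
`∫₀^∞ r^{2n−1} φ(r) dr ≤ n (∫₀^∞ r^{n−1} φ(r)^{1/2} dr)²`
(as an inequality of extended nonnegative reals, both sides possibly infinite). -/
theorem lintegral_pow_mul_mixing_le_sq
    (n : ℕ) (hn : 1 ≤ n) (φ : ℝ → ℝ)
    (hnonneg : ∀ r, 0 ≤ r → 0 ≤ φ r)
    (hmono : AntitoneOn φ (Set.Ici 0)) :
    (∫⁻ r in Set.Ioi (0 : ℝ), ENNReal.ofReal (r ^ (2 * n - 1) * φ r))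
      ≤ n * (∫⁻ r in Set.Ioi (0 : ℝ), ENNReal.ofReal (r ^ (n - 1) * Real.sqrt (φ r))) ^ 2 := by
  set I := ∫⁻ r in Set.Ioi (0 : ℝ), ENNReal.ofReal (r ^ (n - 1) * Real.sqrt (φ r)) with hI
  have hn0 : (n : ENNReal) ≠ 0 := by exact_mod_cast (by omega : n ≠ 0)
  by_cases htop : I = ⊤
  · simp [htop, ENNReal.mul_top hn0]
  calc ∫⁻ r in Set.Ioi (0 : ℝ), ENNReal.ofReal (r ^ (2 * n - 1) * φ r)
      ≤ ∫⁻ r in Set.Ioi (0 : ℝ), n * I * ENNReal.ofReal (r ^ (n - 1) * Real.sqrt (φ r)) := by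
        refine setLIntegral_mono' measurableSet_Ioi fun r hr => ?_
        have hr0 : 0 ≤ r := le_of_lt hr
        have hsplit : r ^ (2 * n - 1) * φ r =
            (r ^ n * Real.sqrt (φ r)) * (r ^ (n - 1) * Real.sqrt (φ r)) := by
          rw [mul_mul_mul_comm, ← pow_add, Real.mul_self_sqrt (hnonneg r hr0)]
          congr 2
          omega
        rw [hsplit, ENNReal.ofReal_mul (by positivity)]
        gcongr
        exact ofReal_pow_mul_le_lintegral_of_antitoneOn hn (fun _ _ => Real.sqrt_nonneg _)
          (fun x hx y hy hxy => Real.sqrt_le_sqrt (hmono hx hy hxy)) hr0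
    _ = n * I ^ 2 := by
        rw [lintegral_const_mul' _ _ (ENNReal.mul_ne_top (ENNReal.natCast_ne_top n) htop), ← hI,
          sq, mul_assoc]
end

section
/- Let n ≥ 1, m > 0, and let f ∈ L¹(ℝⁿ) be complex-valued. Then ∫_{ℝⁿ} e^{2 i t ω(k)} f(k) dk → 0 as t → ∞, where ω(k) = √(|k|² + m²). -/
open MeasureTheory Filter

open scoped FourierTransform ENNReal

/-- A Riemann–Lebesgue lemma for finite measures on `ℝ`. -/
theorem tendsto_integral_fourierChar_of_absolutelyContinuous
    (ν : Measure ℝ) [IsFiniteMeasure ν] (hν : ν ≪ volume) :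
    Tendsto (fun w : ℝ => ∫ x, (𝐞 (-(x * w)) : ℂ) ∂ν) (cocompact ℝ) (nhds 0) := by
  refine (Real.tendsto_integral_exp_smul_cocompact
    (fun x => ((ν.rnDeriv volume x).toReal : ℂ))).congr fun w => ?_
  rw [← integral_rnDeriv_smul hν]
  refine integral_congr_ae (.of_forall fun x => ?_)
  simp [Circle.smul_def, mul_comm]

/-- A Riemann–Lebesgue lemma for a phase function that pulls back Lebesgue-null sets to
null sets. -/
theorem MeasureTheory.Measure.QuasiMeasurePreserving.tendsto_integral_fourierChar_smul
    {α : Type*} [MeasurableSpace α] {μ : Measure α} {φ : α → ℝ}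
    (hφ : Measure.QuasiMeasurePreserving φ μ volume) {f : α → ℂ} (hf : Integrable f μ) :
    Tendsto (fun w : ℝ => ∫ x, 𝐞 (-(φ x * w)) • f x ∂μ) (cocompact ℝ) (nhds 0) := by
  have hmeas (w : ℝ) : AEStronglyMeasurable (fun x => 𝐞 (-(φ x * w))) μ :=
    Real.continuous_fourierChar.comp_aestronglyMeasurable
      (hφ.measurable.mul_const w).neg.aestronglyMeasurable
  have hint {g : α → ℂ} (hg : Integrable g μ) (w : ℝ) :
      Integrable (fun x => 𝐞 (-(φ x * w)) • g x) μ :=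
    hg.mono ((hmeas w).smul hg.1) (.of_forall fun x => by simp)
  refine Integrable.induction (fun f : α → ℂ =>
    Tendsto (fun w : ℝ => ∫ x, 𝐞 (-(φ x * w)) • f x ∂μ) (cocompact ℝ) (nhds 0))
    (fun c s hs hμs => ?_) (fun f g _ hf hg ihf ihg => ?_) ?_ (fun f g hfg _ ih => ?_) hf
  · have : IsFiniteMeasure (μ.restrict s) := ⟨by simpa using hμs⟩
    have hac : (μ.restrict s).map φ ≪ volume :=
      (Measure.restrict_le_self.absolutelyContinuous.map hφ.measurable).trans
        hφ.absolutelyContinuous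
    have h := (tendsto_integral_fourierChar_of_absolutelyContinuous _ hac).mul_const c
    rw [zero_mul] at h
    refine h.congr fun w => ?_
    rw [integral_map hφ.measurable.aemeasurable (by fun_prop), ← integral_mul_const,
      ← integral_indicator hs]
    refine integral_congr_ae (.of_forall fun x => ?_)
    by_cases hx : x ∈ s <;> simp [hx, Circle.smul_def]
  · have h := ihf.add ihg
    rw [add_zero] at h
    refine h.congr fun w => ?_
    rw [← integral_add (hint hf w) (hint hg w)]
    simp
  · refine isClosed_of_closure_subset fun f hf => Metric.tendsto_nhds.2 fun ε hε => ?_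
    obtain ⟨g, hg, hfg⟩ := Metric.mem_closure_iff.1 hf (ε / 2) (half_pos hε)
    filter_upwards [Metric.tendsto_nhds.1 hg (ε / 2) (half_pos hε)] with w hw
    rw [dist_zero_right] at hw ⊢
    have hsub : ‖(∫ x, 𝐞 (-(φ x * w)) • f x ∂μ) - ∫ x, 𝐞 (-(φ x * w)) • g x ∂μ‖ < ε / 2 := by
      rw [← integral_sub (hint (L1.integrable_coeFn f) w) (hint (L1.integrable_coeFn g) w)]
      refine (norm_integral_le_integral_norm _).trans_lt ?_
      rw [L1.dist_eq_integral_dist] at hfg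
      simpa [← smul_sub, dist_eq_norm] using hfg
    linarith [norm_le_norm_sub_add (∫ x, 𝐞 (-(φ x * w)) • f x ∂μ)
      (∫ x, 𝐞 (-(φ x * w)) • g x ∂μ)]
  · refine ih.congr fun w => integral_congr_ae ?_
    filter_upwards [hfg] with x hx
    rw [hx]

theorem quasiMeasurePreserving_norm {E : Type*} [NormedAddCommGroup E] [NormedSpace ℝ E]
    [Nontrivial E] [FiniteDimensional ℝ E] [MeasurableSpace E] [BorelSpace E]
    (μ : Measure E) [μ.IsAddHaarMeasure] :
    Measure.QuasiMeasurePreserving (fun x : E => ‖x‖) μ volume := by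
  refine ⟨measurable_norm, .mk fun s hs hs0 => ?_⟩
  rw [Measure.map_apply measurable_norm hs]
  have hae : (fun y : ℝ => y ^ (Module.finrank ℝ E - 1) • s.indicator (1 : ℝ → ℝ) y)
      =ᵐ[volume.restrict (Set.Ioi 0)] 0 := by
    filter_upwards [ae_restrict_of_ae (measure_eq_zero_iff_ae_notMem.1 hs0)] with y hy
    simp [hy]
  have hcomp : (fun x : E => s.indicator (1 : ℝ → ℝ) ‖x‖)
      = ((fun x : E => ‖x‖) ⁻¹' s).indicator 1 := rfl
  have hs' := measurable_norm (α := E) hs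
  have hI := (integrable_fun_norm_addHaar μ (f := s.indicator (1 : ℝ → ℝ))).2
    ((integrable_zero ℝ ℝ _).congr hae.symm)
  have h0 := integral_fun_norm_addHaar μ (s.indicator (1 : ℝ → ℝ))
  rw [integral_congr_ae hae, hcomp, integral_indicator_one hs'] at h0
  rw [hcomp, integrable_indicator_iff hs'] at hI
  have hfin : μ ((fun x : E => ‖x‖) ⁻¹' s) ≠ ∞ := by
    simpa [Pi.one_def, integrableOn_const_iff, lt_top_iff_ne_top] using hI
  exact (measureReal_eq_zero_iff hfin).1 (by simpa using h0)

theorem quasiMeasurePreserving_sqrt_norm_sq_add_sq {E : Type*} [NormedAddCommGroup E]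
    [NormedSpace ℝ E] [Nontrivial E] [FiniteDimensional ℝ E] [MeasurableSpace E] [BorelSpace E]
    (μ : Measure E) [μ.IsAddHaarMeasure] (m : ℝ) :
    Measure.QuasiMeasurePreserving (fun x : E => √(‖x‖ ^ 2 + m ^ 2)) μ volume := by
  have hmeas : Measurable fun x : E => √(‖x‖ ^ 2 + m ^ 2) := by fun_prop
  refine ⟨hmeas, .mk fun s hs hs0 => ?_⟩
  rw [Measure.map_apply hmeas hs]
  have himage : volume ((fun y : ℝ => √(y ^ 2 - m ^ 2)) '' (s ∩ {y | y ^ 2 - m ^ 2 ≠ 0})) = 0 := by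
    refine addHaar_image_eq_zero_of_differentiableOn_of_addHaar_eq_zero _ (fun y hy => ?_)
      (measure_mono_null Set.inter_subset_left hs0)
    exact (DifferentiableAt.sqrt (f := fun y : ℝ => y ^ 2 - m ^ 2) (by fun_prop)
      hy.2).differentiableWithinAt
  refine measure_mono_null (fun x hx => ?_) (measure_union_null
    ((quasiMeasurePreserving_norm μ).preimage_null himage) (measure_singleton (0 : E)))
  rcases eq_or_ne x 0 with rfl | hx0
  · exact Or.inr rfl
  · have hsq : √(‖x‖ ^ 2 + m ^ 2) ^ 2 - m ^ 2 = ‖x‖ ^ 2 := by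
      rw [Real.sq_sqrt (by positivity)]
      ring
    refine Or.inl ⟨_, ⟨hx, ?_⟩, ?_⟩
    · simpa [hsq] using hx0
    · simp [hsq]

/-- Riemann–Lebesgue-type lemma for the Klein–Gordon dispersion relation
`ω(k) = √(|k|² + m²)`: for `f ∈ L¹(ℝⁿ)`, `∫ e^{2itω(k)} f(k) dk → 0` as `t → ∞`. -/
theorem riemann_lebesgue_klein_gordon
    (n : ℕ) (hn : 1 ≤ n) (m : ℝ) (hm : 0 < m)
    (f : EuclideanSpace ℝ (Fin n) → ℂ) (hf : Integrable f) :
    Tendsto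
      (fun t : ℝ => ∫ k : EuclideanSpace ℝ (Fin n),
        Complex.exp (2 * Complex.I * (t : ℂ) * (Real.sqrt (‖k‖ ^ 2 + m ^ 2) : ℂ)) * f k)
      atTop (nhds 0) := by
  have : NeZero n := ⟨by omega⟩
  have hlim : Tendsto (fun t : ℝ => (-Real.pi⁻¹) * t) atTop (cocompact ℝ) :=
    (tendsto_id.const_mul_atTop_of_neg (by simp [Real.pi_pos])).mono_right atBot_le_cocompact
  refine (((quasiMeasurePreserving_sqrt_norm_sq_add_sq volume m).tendsto_integral_fourierChar_smul
    hf).comp hlim).congr fun t => integral_congr_ae (.of_forall fun k => ?_)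
  simp only [Circle.smul_def, Real.fourierChar_apply, smul_eq_mul]
  congr 2
  push_cast
  field_simp
end
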